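/- There exists ε₀ > 0, depending only on S and k, such that for every ε ≤ ε₀ and every k-fission H of S within ε the following holds: if p and q are two points lying in the same v-cluster and {p,q} is a halving edge of H, then the line through p and q meets the closed ball of radius ε around some point w of S for which {v,w} is a halving edge of S; that is, the direction of the line pq lies in the ε-corridor of a halving edge of S with endpoint v. -/

import Mathlib

noncomputable section

/-- The plane. -/
abbrev Pt : Type := EuclideanSpace ℝ (Fin 2)

/-- Signed determinant of the triple `(p, q, r)`: positive iff `r` lies on the left of
the directed line from `p` to `q`. -/
def det2 (p q r : Pt) : ℝ :=
  (q 0 - p 0) * (r 1 - p 1) - (q 1 - p 1) * (r 0 - p 0)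

/-- A finite set of points in the plane is in general position if no three of its
(distinct) points are collinear. -/
def GenPos (S : Finset Pt) : Prop :=
  ∀ p ∈ S, ∀ q ∈ S, ∀ r ∈ S, p ≠ q → p ≠ r → q ≠ r →
    ¬ Collinear ℝ ({p, q, r} : Set Pt)

/-- `{p, q}` is a halving edge of `S`: `p, q` are distinct points of `S` and the open
half-planes on the two sides of the line through `p` and `q` each contain exactly
`(|S| - 2)/2` points of `S`. -/
def HalvingEdge (S : Finset Pt) (p q : Pt) : Prop :=
  p ∈ S ∧ q ∈ S ∧ p ≠ q ∧
    {r ∈ (S : Set Pt) | 0 < det2 p q r}.ncard = (S.card - 2) / 2 ∧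
    {r ∈ (S : Set Pt) | det2 p q r < 0}.ncard = (S.card - 2) / 2

/-- The halving edges graph of `S` (as a graph on the whole plane; all vertices
outside `S` are isolated). -/
def halvingGraph (S : Finset Pt) : SimpleGraph Pt :=
  SimpleGraph.fromRel (HalvingEdge S)

/-- The number of halving edges of `S`. -/
def halvingEdgeCount (S : Finset Pt) : ℕ :=
  {e : Sym2 Pt | ∃ p q, e = s(p, q) ∧ HalvingEdge S p q}.ncard

/-- `H`, together with the cluster map `cl`, is a `k`-fission of `S` within `ε`:
`H` is a set of `k * |S|` points in general position partitioned into clusters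
`cl v` of `k` points, one for each `v ∈ S`, with each point of the `v`-cluster
within distance `ε` of `v`. -/
structure IsFission (S : Finset Pt) (k : ℕ) (ε : ℝ) (H : Finset Pt)
    (cl : Pt → Finset Pt) : Prop where
  genPos : GenPos H
  cluster_card : ∀ v ∈ S, (cl v).card = k
  disj : ∀ v ∈ S, ∀ w ∈ S, v ≠ w → Disjoint (cl v) (cl w)
  union_eq : (H : Set Pt) = ⋃ v ∈ S, (cl v : Set Pt)
  close : ∀ v ∈ S, ∀ x ∈ cl v, dist x v ≤ ε

/-- A fission is plain if no halving edge of `H` has both endpoints in the same cluster. -/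
def IsPlain (S : Finset Pt) (H : Finset Pt) (cl : Pt → Finset Pt) : Prop :=
  ∀ v ∈ S, ∀ p ∈ cl v, ∀ q ∈ cl v, ¬ HalvingEdge H p q


local instance : DecidableEq Pt := Classical.decEq _

open Filter Topology in
/-- Near a triple with nonzero determinant, the sign of the determinant is constant. -/
theorem eventually_det2_mul_pos {v w r : Pt} (h : det2 v w r ≠ 0) :
    ∀ᶠ δ in 𝓝[>] (0 : ℝ), ∀ x y z, dist x v ≤ δ → dist y w ≤ δ → dist z r ≤ δ →
      0 < det2 v w r * det2 x y z := by
  have hc : Continuous fun a : Pt × Pt × Pt => det2 v w r * det2 a.1 a.2.1 a.2.2 := by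
    unfold det2
    fun_prop
  have hev : ∀ᶠ a in 𝓝 (v, w, r), 0 < det2 v w r * det2 a.1 a.2.1 a.2.2 :=
    hc.continuousAt.eventually (lt_mem_nhds (mul_self_pos.mpr h))
  obtain ⟨δ, hδ, hb⟩ := Metric.eventually_nhds_iff.mp hev
  filter_upwards [Ioo_mem_nhdsGT hδ] with η hη x y z hx hy hz
  refine @hb (x, y, z) ?_
  simp only [Prod.dist_eq, max_lt_iff]
  exact ⟨hx.trans_lt hη.2, hy.trans_lt hη.2, hz.trans_lt hη.2⟩

theorem exists_lineMap_eq_of_det2_eq_zero {p q z : Pt} (hpq : p ≠ q) (h : det2 p q z = 0) :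
    ∃ t : ℝ, AffineMap.lineMap p q t = z := by
  have hne : q 0 - p 0 ≠ 0 ∨ q 1 - p 1 ≠ 0 := by
    by_contra! hcon
    apply hpq
    ext i
    fin_cases i
    · exact (sub_eq_zero.mp hcon.1).symm
    · exact (sub_eq_zero.mp hcon.2).symm
  unfold det2 at h
  rcases hne with hne | hne
  · refine ⟨(z 0 - p 0) / (q 0 - p 0), ?_⟩
    ext i
    fin_cases i <;> simp [AffineMap.lineMap_apply] <;> field_simp <;> linarith
  · refine ⟨(z 1 - p 1) / (q 1 - p 1), ?_⟩
    ext i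
    fin_cases i <;> simp [AffineMap.lineMap_apply] <;> field_simp <;> linarith

theorem det2_lineMap (p q c : Pt) (t : ℝ) :
    det2 p (AffineMap.lineMap p q t) c = t * det2 p q c := by
  simp [det2, AffineMap.lineMap_apply]
  ring

theorem GenPos.det2_ne_zero {S : Finset Pt} (hS : GenPos S) {v w r : Pt} (hv : v ∈ S)
    (hw : w ∈ S) (hr : r ∈ S) (hvw : v ≠ w) (hvr : v ≠ r) (hwr : w ≠ r) :
    det2 v w r ≠ 0 := by
  intro h
  obtain ⟨t, rfl⟩ := exists_lineMap_eq_of_det2_eq_zero hvw h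
  refine hS _ hr v hv w hw hvr.symm hwr.symm hvw
    (collinear_insert_of_mem_affineSpan_pair (AffineMap.lineMap_mem_affineSpan_pair t v w))

/-- A line that misses a closed ball leaves it on one side. -/
theorem det2_pos_or_neg_of_forall_ne_zero {p q w : Pt} {ε : ℝ}
    (h : ∀ z, dist z w ≤ ε → det2 p q z ≠ 0) :
    (∀ z, dist z w ≤ ε → 0 < det2 p q z) ∨ (∀ z, dist z w ≤ ε → det2 p q z < 0) := by
  by_contra! hcon
  obtain ⟨⟨x, hx, hx0⟩, y, hy, hy0⟩ := hcon
  have hc : Continuous (det2 p q) := by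
    unfold det2
    fun_prop
  obtain ⟨z, hz, hz0⟩ := (convex_closedBall w ε).isPreconnected.intermediate_value
    (Metric.mem_closedBall.mpr hx) (Metric.mem_closedBall.mpr hy) hc.continuousOn
    (Set.mem_Icc.mpr ⟨hx0, hy0⟩)
  exact h z hz hz0

namespace IsFission

variable {S H : Finset Pt} {k : ℕ} {ε : ℝ} {cl : Pt → Finset Pt}

theorem cluster_subset (hf : IsFission S k ε H cl) {v : Pt} (hv : v ∈ S) : cl v ⊆ H := by
  intro c hc
  rw [← Finset.mem_coe, hf.union_eq]
  exact Set.mem_biUnion hv hc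

theorem card_biUnion (hf : IsFission S k ε H cl) {T : Finset Pt} (hT : T ⊆ S) :
    (T.biUnion cl).card = T.card * k := by
  rw [Finset.card_biUnion fun v hv w hw => hf.disj v (hT hv) w (hT hw)]
  exact Finset.sum_const_nat fun v hv => hf.cluster_card v (hT hv)

theorem card_eq (hf : IsFission S k ε H cl) : H.card = S.card * k := by
  rw [← hf.card_biUnion subset_rfl]
  congr 1
  apply Finset.coe_injective
  rw [hf.union_eq, Finset.coe_biUnion]
  rfl

/-- A side of a halving edge of a fission contains fewer than half of the clusters. -/
theorem card_add_one_le (hf : IsFission S k ε H cl) (hH : 2 ≤ H.card) {m : ℕ}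
    (hm : S.card = m + m) {T : Finset Pt} (hT : T ⊆ S) {P : Pt → Prop}
    (hP : ∀ w ∈ T, ∀ c ∈ cl w, P c)
    (hcard : {c ∈ (H : Set Pt) | P c}.ncard = (H.card - 2) / 2) : T.card + 1 ≤ m := by
  have hsub : (T.biUnion cl : Set Pt) ⊆ {c ∈ (H : Set Pt) | P c} := by
    intro c hc
    obtain ⟨w, hw, hcw⟩ := Finset.mem_biUnion.mp hc
    exact ⟨hf.cluster_subset (hT hw) hcw, hP w hw c hcw⟩
  have hle := Set.ncard_le_ncard hsub (H.finite_toSet.subset fun c hc => hc.1)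
  rw [Set.ncard_coe_finset, hf.card_biUnion hT, hcard] at hle
  have hHc : H.card = m * k + m * k := by rw [hf.card_eq, hm, add_mul]
  have hlt : T.card * k < m * k := by omega
  exact lt_of_mul_lt_mul_right hlt k.zero_le

/-- The line spanned by a halving edge inside the `v`-cluster meets the ball around another
point of `S`. -/
theorem exists_det2_eq_zero (hf : IsFission S k ε H cl) (hcard : Even S.card) {v p q : Pt}
    (hv : v ∈ S) (hpq : HalvingEdge H p q) :
    ∃ w ∈ S, w ≠ v ∧ ∃ z, dist z w ≤ ε ∧ det2 p q z = 0 := by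
  classical
  obtain ⟨hp, hq, hne, hpos, hneg⟩ := hpq
  obtain ⟨m, hm⟩ := hcard
  have hH : 2 ≤ H.card := Finset.one_lt_card.mpr ⟨p, hp, q, hq, hne⟩
  by_contra! hcon
  have h₁ := hf.card_add_one_le hH hm (T := {w ∈ S | ∀ c ∈ cl w, 0 < det2 p q c})
    (Finset.filter_subset _ _) (fun w hw => (Finset.mem_filter.mp hw).2) hpos
  have h₂ := hf.card_add_one_le hH hm (T := {w ∈ S | ∀ c ∈ cl w, det2 p q c < 0})
    (Finset.filter_subset _ _) (fun w hw => (Finset.mem_filter.mp hw).2) hneg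
  have hsub : S.erase v ⊆ {w ∈ S | ∀ c ∈ cl w, 0 < det2 p q c} ∪
      {w ∈ S | ∀ c ∈ cl w, det2 p q c < 0} := by
    intro w hw
    obtain ⟨hwv, hwS⟩ := Finset.mem_erase.mp hw
    rw [Finset.mem_union, Finset.mem_filter, Finset.mem_filter]
    exact (det2_pos_or_neg_of_forall_ne_zero (hcon w hwS hwv)).imp
      (fun h => ⟨hwS, fun c hc => h c (hf.close w hwS c hc)⟩)
      (fun h => ⟨hwS, fun c hc => h c (hf.close w hwS c hc)⟩)
  have h₃ := (Finset.card_le_card hsub).trans (Finset.card_union_le _ _)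
  rw [Finset.card_erase_of_mem hv] at h₃
  omega

end IsFission

/-- If neither side of the line `vw` contains half of the points, then `{v, w}` is halving. -/
theorem GenPos.halvingEdge_of_card {S : Finset Pt} (hS : GenPos S) {m : ℕ}
    (hm : S.card = m + m) {v w : Pt} (hv : v ∈ S) (hw : w ∈ S) (hvw : v ≠ w)
    (h₁ : (S.filter fun r => 0 < det2 v w r).card + 1 ≤ m)
    (h₂ : (S.filter fun r => det2 v w r < 0).card + 1 ≤ m) : HalvingEdge S v w := by
  classical
  have hsub : (S.erase v).erase w ⊆
      (S.filter fun r => 0 < det2 v w r) ∪ (S.filter fun r => det2 v w r < 0) := by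
    intro r hr
    simp only [Finset.mem_erase] at hr
    have := hS.det2_ne_zero hv hw hr.2.2 hvw hr.2.1.symm hr.1.symm
    rw [Finset.mem_union, Finset.mem_filter, Finset.mem_filter]
    exact this.lt_or_gt.symm.imp (fun h => ⟨hr.2.2, h⟩) (fun h => ⟨hr.2.2, h⟩)
  have h₃ := (Finset.card_le_card hsub).trans (Finset.card_union_le _ _)
  rw [Finset.card_erase_of_mem (Finset.mem_erase.mpr ⟨hvw.symm, hw⟩),
    Finset.card_erase_of_mem hv] at h₃
  refine ⟨hv, hw, hvw, ?_, ?_⟩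
  · rw [show {r ∈ (S : Set Pt) | _} = (S.filter _ : Set Pt) from (Finset.coe_filter _ _).symm, Set.ncard_coe_finset]
    omega
  · rw [show {r ∈ (S : Set Pt) | _} = (S.filter _ : Set Pt) from (Finset.coe_filter _ _).symm, Set.ncard_coe_finset]
    omega

theorem stmt7 (S : Finset Pt) (hS : GenPos S) (hcard : Even S.card)
    (k : ℕ) (hk : 1 ≤ k) :
    ∃ ε₀ > 0, ∀ ε : ℝ, 0 < ε → ε ≤ ε₀ →
      ∀ (H : Finset Pt) (cl : Pt → Finset Pt), IsFission S k ε H cl →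
        ∀ v ∈ S, ∀ p ∈ cl v, ∀ q ∈ cl v, HalvingEdge H p q →
          ∃ w ∈ S, HalvingEdge S v w ∧
            ∃ z ∈ (affineSpan ℝ ({p, q} : Set Pt) : Set Pt), dist z w ≤ ε := by
  obtain ⟨m, hm⟩ := hcard
  have hev : ∀ᶠ δ in nhdsWithin (0 : ℝ) (Set.Ioi 0), ∀ v ∈ S, ∀ w ∈ S, ∀ r ∈ S,
      det2 v w r ≠ 0 → ∀ x y z, dist x v ≤ δ → dist y w ≤ δ → dist z r ≤ δ →
        0 < det2 v w r * det2 x y z := by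
    simp only [Filter.eventually_all_finset]
    intro v _ w _ r _
    by_cases h : det2 v w r = 0
    · simp [h]
    · exact (eventually_det2_mul_pos h).mono fun δ hδ _ => hδ
  obtain ⟨ε₀, hε₀, hpos⟩ := (hev.and self_mem_nhdsWithin).exists
  refine ⟨ε₀, hpos, fun ε _ hε H cl hf v hv p hp q hq hpq => ?_⟩
  obtain ⟨w, hw, hwv, z, hzw, hz⟩ := hf.exists_det2_eq_zero ⟨m, hm⟩ hv hpq
  obtain ⟨hpH, hqH, hne, hleft, hright⟩ := hpq
  obtain ⟨t, rfl⟩ := exists_lineMap_eq_of_det2_eq_zero hne hz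
  refine ⟨w, hw, ?_, _, AffineMap.lineMap_mem_affineSpan_pair t p q, hzw⟩
  have hH : 2 ≤ H.card := Finset.one_lt_card.mpr ⟨p, hpH, q, hqH, hne⟩
  have hsign : ∀ r ∈ S, det2 v w r ≠ 0 → ∀ c ∈ cl r, 0 < det2 v w r * (t * det2 p q c) := by
    intro r hr h c hc
    rw [← det2_lineMap]
    exact hε₀ v hv w hw r hr h _ _ _ ((hf.close v hv p hp).trans hε) (hzw.trans hε)
      ((hf.close r hr c hc).trans hε)
  have hside₁ : ∀ r ∈ S.filter fun r => 0 < det2 v w r, ∀ c ∈ cl r, 0 < t * det2 p q c := by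
    intro r hr c hc
    obtain ⟨hrS, hr⟩ := Finset.mem_filter.mp hr
    exact (mul_pos_iff_of_pos_left hr).mp (hsign r hrS hr.ne' c hc)
  have hside₂ : ∀ r ∈ S.filter fun r => det2 v w r < 0, ∀ c ∈ cl r, t * det2 p q c < 0 := by
    intro r hr c hc
    obtain ⟨hrS, hr⟩ := Finset.mem_filter.mp hr
    exact neg_of_mul_pos_right (hsign r hrS hr.ne c hc) hr.le
  have key : ∀ T ⊆ S, ∀ P : Pt → Prop, (∀ r ∈ T, ∀ c ∈ cl r, P c) →
      {c ∈ (H : Set Pt) | P c}.ncard = (H.card - 2) / 2 → T.card + 1 ≤ m :=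
    fun T hT P hP hc => hf.card_add_one_le hH hm hT hP hc
  rcases lt_trichotomy t 0 with ht | rfl | ht
  · refine hS.halvingEdge_of_card hm hv hw hwv.symm
      (key _ (Finset.filter_subset _ _) _ (fun r hr c hc => ?_) hright)
      (key _ (Finset.filter_subset _ _) _ (fun r hr c hc => ?_) hleft)
    · exact neg_of_mul_pos_right (hside₁ r hr c hc) ht.le
    · exact pos_of_mul_neg_right (hside₂ r hr c hc) ht.le
  · refine hS.halvingEdge_of_card hm hv hw hwv.symm
      (key _ (Finset.filter_subset _ _) _ (fun r hr c hc => ?_) hleft)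
      (key _ (Finset.filter_subset _ _) _ (fun r hr c hc => ?_) hright)
    · simpa using hside₁ r hr c hc
    · simpa using hside₂ r hr c hc
  · refine hS.halvingEdge_of_card hm hv hw hwv.symm
      (key _ (Finset.filter_subset _ _) _ (fun r hr c hc => ?_) hleft)
      (key _ (Finset.filter_subset _ _) _ (fun r hr c hc => ?_) hright)
    · exact (mul_pos_iff_of_pos_left ht).mp (hside₁ r hr c hc)
    · exact neg_of_mul_neg_right (hside₂ r hr c hc) ht.le

end
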